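/- Proposition (GBDT for symplectic/Hamiltonian-type systems): let y(x,λ) satisfy y′ = J(λH₁(x) + H₀(x))y with J* = −J and H₁, H₀ Hermitian, and let the GBDT with parameter matrices {A, S(0) = S(0)*, Π(0)} satisfying AS(0) − S(0)A* = Π(0)JΠ(0)* be given, with Π(x), S(x) determined by Π′ = −AΠJH₁ − ΠJH₀ and S′ = ΠJH₁J*Π*. Then ỹ(x,λ) := w_A(x,λ)y(x,λ), where w_A(x,λ) = I_m − JΠ(x)*S(x)⁻¹(A − λI_n)⁻¹Π(x), satisfies at every point x where S(x) and (A − λI_n) are invertible the transformed system ỹ′ = J(λH₁(x) + H̃₀(x))ỹ, where H̃₀ = H₀ + Z, Z(x) = Π(x)*S(x)⁻¹Π(x)JH₁(x) + H₁(x)J*Π(x)*S(x)⁻¹Π(x), and H̃₀(x) is Hermitian. -/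

import Mathlib

open Matrix Set

attribute [local instance] Matrix.normedAddCommGroup Matrix.normedSpace

section MatrixDerivatives

variable {l m n : Type*} [Fintype l] [Fintype m] [Fintype n]

omit [Fintype m] in
theorem hasDerivAt_matrix_iff {f : ℝ → Matrix m n ℂ} {f' : Matrix m n ℂ} {x : ℝ} :
    HasDerivAt f f' x ↔ ∀ i j, HasDerivAt (fun t => f t i j) (f' i j) x :=
  hasDerivAt_pi.trans (forall_congr' fun _ => hasDerivAt_pi)

omit [Fintype l] in
theorem HasDerivAt.matrix_mul {f : ℝ → Matrix l m ℂ} {g : ℝ → Matrix m n ℂ}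
    {f' : Matrix l m ℂ} {g' : Matrix m n ℂ} {x : ℝ}
    (hf : HasDerivAt f f' x) (hg : HasDerivAt g g' x) :
    HasDerivAt (fun t => f t * g t) (f' * g x + f x * g') x := by
  rw [hasDerivAt_matrix_iff] at *
  intro i j
  simp only [Matrix.mul_apply, Matrix.add_apply, ← Finset.sum_add_distrib]
  exact HasDerivAt.fun_sum fun k _ => (hf i k).mul (hg k j)

omit [Fintype m] in
theorem HasDerivAt.matrix_mulVec {f : ℝ → Matrix m n ℂ} {v : ℝ → n → ℂ}
    {f' : Matrix m n ℂ} {v' : n → ℂ} {x : ℝ}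
    (hf : HasDerivAt f f' x) (hv : HasDerivAt v v' x) :
    HasDerivAt (fun t => f t *ᵥ v t) (f' *ᵥ v x + f x *ᵥ v') x := by
  rw [hasDerivAt_matrix_iff] at hf
  rw [hasDerivAt_pi] at *
  intro i
  simp only [Matrix.mulVec, dotProduct, Pi.add_apply, ← Finset.sum_add_distrib]
  exact HasDerivAt.fun_sum fun k _ => (hf i k).mul (hv k)

theorem HasDerivAt.matrix_conjTranspose {f : ℝ → Matrix m n ℂ} {f' : Matrix m n ℂ} {x : ℝ}
    (hf : HasDerivAt f f' x) : HasDerivAt (fun t => (f t)ᴴ) f'ᴴ x := by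
  rw [hasDerivAt_matrix_iff] at *
  exact fun i j => (hf j i).star

theorem HasDerivAt.matrix_inv [DecidableEq n] {f : ℝ → Matrix n n ℂ} {f' : Matrix n n ℂ} {x : ℝ}
    (hf : HasDerivAt f f' x) (hx : IsUnit (f x)) :
    HasDerivAt (fun t => (f t)⁻¹) (-((f x)⁻¹ * f' * (f x)⁻¹)) x := by
  have hdet : IsUnit (f x).det := (Matrix.isUnit_iff_isUnit_det _).1 hx
  have hcdet : ContinuousAt (fun t => (f t).det) x :=
    (continuous_id.matrix_det.continuousAt (x := f x)).comp hf.continuousAt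
  have hcinv : ContinuousAt (fun t => (f t)⁻¹) x := by
    simp only [Matrix.inv_def, Ring.inverse_eq_inv']
    exact (hcdet.inv₀ hdet.ne_zero).smul
      ((continuous_id.matrix_adjugate.continuousAt (x := f x)).comp hf.continuousAt)
  have hslope := hasDerivAt_iff_tendsto_slope.1 hf
  refine hasDerivAt_iff_tendsto_slope.2 ?_
  have hmul : Continuous fun p : Matrix n n ℂ × Matrix n n ℂ => -(p.1 * p.2 * (f x)⁻¹) := by
    fun_prop
  refine ((hmul.tendsto ((f x)⁻¹, f')).comp
    ((hcinv.tendsto.mono_left nhdsWithin_le_nhds).prodMk_nhds hslope)).congr' ?_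
  filter_upwards [nhdsWithin_le_nhds (hcdet.eventually_ne hdet.ne_zero)] with t ht
  have h1 : (f t)⁻¹ * f t = 1 := Matrix.nonsing_inv_mul _ (isUnit_iff_ne_zero.2 ht)
  have h2 : f x * (f x)⁻¹ = 1 := Matrix.mul_nonsing_inv _ hdet
  simp only [Function.comp_apply, slope_def_module, Matrix.mul_smul, Matrix.smul_mul, ← smul_neg]
  congr 1
  rw [mul_sub, sub_mul, h1, one_mul, mul_assoc, h2, mul_one, neg_sub]

theorem eq_of_hasDerivAt_zero {f : ℝ → Matrix m n ℂ} {ℓ : ℝ}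
    (hf : ∀ x ∈ Ico (0 : ℝ) ℓ, HasDerivAt f 0 x) : ∀ x ∈ Ico (0 : ℝ) ℓ, f x = f 0 := by
  intro x hx
  have hmem : ∀ t ∈ Icc 0 x, t ∈ Ico (0 : ℝ) ℓ := fun t ht => ⟨ht.1, ht.2.trans_lt hx.2⟩
  exact constant_of_has_deriv_right_zero
    (fun t ht => (hf t (hmem t ht)).continuousAt.continuousWithinAt)
    (fun t ht => (hf t (hmem t (Ico_subset_Icc_self ht))).hasDerivWithinAt) x ⟨hx.1, le_rfl⟩

end MatrixDerivatives

section GBDT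

variable {m n : Type*} [Fintype m] [Fintype n] {ℓ : ℝ}
  {J : Matrix m m ℂ} {H₁ H₀ : ℝ → Matrix m m ℂ} {A : Matrix n n ℂ}
  {Pi : ℝ → Matrix n m ℂ} {S : ℝ → Matrix n n ℂ}

theorem gbdt_isHermitian (hJ : Jᴴ = -J) (hH₁ : ∀ x ∈ Ico (0 : ℝ) ℓ, (H₁ x).IsHermitian)
    (hS0 : (S 0).IsHermitian)
    (hS : ∀ x ∈ Ico (0 : ℝ) ℓ, HasDerivAt S (Pi x * J * H₁ x * Jᴴ * (Pi x)ᴴ) x) :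
    ∀ x ∈ Ico (0 : ℝ) ℓ, (S x).IsHermitian := by
  intro x hx
  have h := eq_of_hasDerivAt_zero (f := fun t => (S t)ᴴ - S t) (ℓ := ℓ) (fun t ht => by
    refine ((hS t ht).matrix_conjTranspose.sub (hS t ht)).congr_deriv ?_
    simp [Matrix.conjTranspose_mul, hJ, (hH₁ t ht).eq, Matrix.mul_assoc]) x hx
  simp only [hS0.eq, sub_self] at h
  exact sub_eq_zero.1 h

theorem gbdt_identity (hJ : Jᴴ = -J) (hH₁ : ∀ x ∈ Ico (0 : ℝ) ℓ, (H₁ x).IsHermitian)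
    (hH₀ : ∀ x ∈ Ico (0 : ℝ) ℓ, (H₀ x).IsHermitian)
    (hInit : A * S 0 - S 0 * Aᴴ = Pi 0 * J * (Pi 0)ᴴ)
    (hPi : ∀ x ∈ Ico (0 : ℝ) ℓ,
      HasDerivAt Pi (-(A * Pi x * J * H₁ x) - Pi x * J * H₀ x) x)
    (hS : ∀ x ∈ Ico (0 : ℝ) ℓ, HasDerivAt S (Pi x * J * H₁ x * Jᴴ * (Pi x)ᴴ) x) :
    ∀ x ∈ Ico (0 : ℝ) ℓ, A * S x - S x * Aᴴ = Pi x * J * (Pi x)ᴴ := by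
  intro x hx
  have h := eq_of_hasDerivAt_zero
    (f := fun t => A * S t - S t * Aᴴ - Pi t * J * (Pi t)ᴴ) (ℓ := ℓ) (fun t ht => by
    refine ((((hasDerivAt_const t A).matrix_mul (hS t ht)).sub
      ((hS t ht).matrix_mul (hasDerivAt_const t Aᴴ))).sub
      (((hPi t ht).matrix_mul (hasDerivAt_const t J)).matrix_mul
        (hPi t ht).matrix_conjTranspose)).congr_deriv ?_
    simp only [Matrix.conjTranspose_mul, Matrix.conjTranspose_sub, Matrix.conjTranspose_neg, hJ,
      (hH₁ t ht).eq, (hH₀ t ht).eq, Matrix.mul_assoc, Matrix.mul_sub, Matrix.sub_mul,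
      Matrix.mul_neg, Matrix.neg_mul, Matrix.mul_zero, Matrix.zero_mul, add_zero, zero_add]
    abel) x hx
  simp only [hInit, sub_self] at h
  exact sub_eq_zero.1 h

variable [DecidableEq m] [DecidableEq n]

/-- The Darboux matrix `w_A` satisfies
`w_A' = J (λ H₁ + H̃₀) w_A - w_A J (λ H₁ + H₀)`. -/
theorem gbdt_hasDerivAt_darbouxMatrix {x : ℝ} {lam : ℂ} (hJ : Jᴴ = -J)
    (hH₁ : (H₁ x).IsHermitian) (hH₀ : (H₀ x).IsHermitian)
    (hid : A * S x - S x * Aᴴ = Pi x * J * (Pi x)ᴴ)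
    (hPi : HasDerivAt Pi (-(A * Pi x * J * H₁ x) - Pi x * J * H₀ x) x)
    (hS : HasDerivAt S (Pi x * J * H₁ x * Jᴴ * (Pi x)ᴴ) x)
    (hSu : IsUnit (S x)) (hAu : IsUnit (A - lam • 1)) :
    HasDerivAt (fun t => 1 - J * (Pi t)ᴴ * (S t)⁻¹ * (A - lam • 1)⁻¹ * Pi t)
      (J * (lam • H₁ x + (H₀ x + ((Pi x)ᴴ * (S x)⁻¹ * Pi x * J * H₁ x
          + H₁ x * Jᴴ * (Pi x)ᴴ * (S x)⁻¹ * Pi x)))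
          * (1 - J * (Pi x)ᴴ * (S x)⁻¹ * (A - lam • 1)⁻¹ * Pi x)
        - (1 - J * (Pi x)ᴴ * (S x)⁻¹ * (A - lam • 1)⁻¹ * Pi x)
          * (J * (lam • H₁ x + H₀ x))) x := by
  set R := (A - lam • 1)⁻¹ with hR
  have hSdet := (Matrix.isUnit_iff_isUnit_det _).1 hSu
  have hAdet := (Matrix.isUnit_iff_isUnit_det _).1 hAu
  have hAR : A * R = 1 + lam • R := by
    have h := Matrix.mul_nonsing_inv _ hAdet
    rw [← hR, sub_mul, smul_mul_assoc, one_mul] at h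
    exact sub_eq_iff_eq_add.1 h
  have hRA : R * A = 1 + lam • R := by
    have h := Matrix.nonsing_inv_mul _ hAdet
    rw [← hR, mul_sub, mul_smul_comm, mul_one] at h
    exact sub_eq_iff_eq_add.1 h
  have hAS : Aᴴ * (S x)⁻¹ = (S x)⁻¹ * A - (S x)⁻¹ * (Pi x * (J * ((Pi x)ᴴ * (S x)⁻¹))) := by
    have h1 := Matrix.nonsing_inv_mul _ hSdet
    have h2 := Matrix.mul_nonsing_inv _ hSdet
    have h := congrArg (fun M => (S x)⁻¹ * M * (S x)⁻¹) hid
    simp only [Matrix.mul_sub, Matrix.sub_mul, Matrix.mul_assoc, h2, Matrix.mul_one] at h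
    rw [← Matrix.mul_assoc _ (S x), h1, Matrix.one_mul] at h
    rw [← h, sub_sub_cancel]
  have hASR : Aᴴ * ((S x)⁻¹ * (R * Pi x)) = (S x)⁻¹ * Pi x + lam • ((S x)⁻¹ * (R * Pi x))
      - (S x)⁻¹ * (Pi x * (J * ((Pi x)ᴴ * ((S x)⁻¹ * (R * Pi x))))) := by
    have h := congrArg (fun M => M * (R * Pi x)) hAS
    simp only [Matrix.sub_mul, Matrix.mul_assoc] at h
    rw [h, ← Matrix.mul_assoc A, hAR]
    simp only [Matrix.add_mul, Matrix.mul_add, Matrix.one_mul, Matrix.smul_mul, Matrix.mul_smul]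
  have hRAP (M : Matrix m m ℂ) : R * (A * (Pi x * M)) = Pi x * M + lam • (R * (Pi x * M)) := by
    rw [← Matrix.mul_assoc R, hRA, Matrix.add_mul, Matrix.one_mul, Matrix.smul_mul]
  refine ((hasDerivAt_const x (1 : Matrix m m ℂ)).sub
    (((((hasDerivAt_const x J).matrix_mul hPi.matrix_conjTranspose).matrix_mul
      (hS.matrix_inv hSu)).matrix_mul (hasDerivAt_const x R)).matrix_mul hPi)).congr_deriv ?_
  simp only [Matrix.conjTranspose_mul, Matrix.conjTranspose_sub, Matrix.conjTranspose_neg, hJ,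
    hH₁.eq, hH₀.eq, Matrix.mul_assoc, Matrix.mul_sub, Matrix.sub_mul, Matrix.mul_add,
    Matrix.add_mul, Matrix.mul_neg, Matrix.neg_mul, Matrix.mul_zero, Matrix.zero_mul,
    Matrix.mul_one, Matrix.one_mul, Matrix.mul_smul, Matrix.smul_mul, hASR, hRAP, smul_sub]
  abel

omit [DecidableEq m] in
theorem gbdt_isHermitian_transformed {S : Matrix n n ℂ} {H₁ H₀ : Matrix m m ℂ} {Pi : Matrix n m ℂ}
    (hS : S.IsHermitian) (hH₁ : H₁.IsHermitian) (hH₀ : H₀.IsHermitian) :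
    (H₀ + (Piᴴ * S⁻¹ * Pi * J * H₁ + H₁ * Jᴴ * Piᴴ * S⁻¹ * Pi)).IsHermitian := by
  refine hH₀.add ?_
  rw [Matrix.IsHermitian, Matrix.conjTranspose_add, add_comm]
  simp only [Matrix.conjTranspose_mul, Matrix.conjTranspose_conjTranspose, hS.inv.eq, hH₁.eq,
    Matrix.mul_assoc]

end GBDT

/-- **GBDT for symplectic/Hamiltonian-type systems.**  Let `y` satisfy
`y' = J (λ H₁(x) + H₀(x)) y` with `J* = −J` and `H₁, H₀` Hermitian, and let the GBDT data
`{A, S(0) = S(0)*, Π(0)}` satisfy `A S(0) − S(0) A* = Π(0) J Π(0)*`, with `Π, S` determined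
by `Π' = −A Π J H₁ − Π J H₀`, `S' = Π J H₁ J* Π*`.  Then `ỹ := w_A y`, with
`w_A(x,λ) = I − J Π(x)* S(x)⁻¹ (A − λ I)⁻¹ Π(x)`, satisfies at every point where `S(x)` and
`A − λ I` are invertible the transformed system `ỹ' = J (λ H₁ + H̃₀) ỹ`, where
`H̃₀ = H₀ + Z`, `Z = Π* S⁻¹ Π J H₁ + H₁ J* Π* S⁻¹ Π`, and `H̃₀(x)` is Hermitian. -/
theorem gbdt_hamiltonian_transformed_system
    (n m : ℕ) (ℓ : ℝ) (lam : ℂ)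
    (J : Matrix (Fin m) (Fin m) ℂ) (hJ : Jᴴ = -J)
    (H₁ H₀ : ℝ → Matrix (Fin m) (Fin m) ℂ)
    (hH₁ : ∀ x ∈ Ico (0 : ℝ) ℓ, (H₁ x).IsHermitian)
    (hH₀ : ∀ x ∈ Ico (0 : ℝ) ℓ, (H₀ x).IsHermitian)
    (A : Matrix (Fin n) (Fin n) ℂ)
    (Pi : ℝ → Matrix (Fin n) (Fin m) ℂ)
    (S : ℝ → Matrix (Fin n) (Fin n) ℂ)
    (hS0 : (S 0).IsHermitian)
    (hInit : A * S 0 - S 0 * Aᴴ = Pi 0 * J * (Pi 0)ᴴ)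
    (hPi : ∀ x ∈ Ico (0 : ℝ) ℓ,
      HasDerivAt Pi (-(A * Pi x * J * H₁ x) - Pi x * J * H₀ x) x)
    (hS : ∀ x ∈ Ico (0 : ℝ) ℓ,
      HasDerivAt S (Pi x * J * H₁ x * Jᴴ * (Pi x)ᴴ) x)
    (wA : ℝ → Matrix (Fin m) (Fin m) ℂ)
    (hwA : wA = fun x => 1 - J * (Pi x)ᴴ * (S x)⁻¹ * (A - lam • 1)⁻¹ * Pi x)
    (Z Ht0 : ℝ → Matrix (Fin m) (Fin m) ℂ)
    (hZ : Z = fun x =>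
      (Pi x)ᴴ * (S x)⁻¹ * Pi x * J * H₁ x + H₁ x * Jᴴ * (Pi x)ᴴ * (S x)⁻¹ * Pi x)
    (hHt0 : Ht0 = fun x => H₀ x + Z x)
    (y : ℝ → Fin m → ℂ)
    (hy : ∀ x ∈ Ico (0 : ℝ) ℓ, HasDerivAt y ((J * (lam • H₁ x + H₀ x)) *ᵥ y x) x) :
    ∀ x ∈ Ico (0 : ℝ) ℓ, IsUnit (S x) → IsUnit (A - lam • 1) →
      HasDerivAt (fun t => wA t *ᵥ y t)
        ((J * (lam • H₁ x + Ht0 x)) *ᵥ (wA x *ᵥ y x)) x ∧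
      (Ht0 x).IsHermitian := by
  intro x hx hSu hAu
  subst hHt0 hZ hwA
  refine ⟨?_, gbdt_isHermitian_transformed (gbdt_isHermitian hJ hH₁ hS0 hS x hx)
    (hH₁ x hx) (hH₀ x hx)⟩
  have hid := gbdt_identity hJ hH₁ hH₀ hInit hPi hS x hx
  refine ((gbdt_hasDerivAt_darbouxMatrix hJ (hH₁ x hx) (hH₀ x hx) hid (hPi x hx) (hS x hx)
    hSu hAu).matrix_mulVec (hy x hx)).congr_deriv ?_
  rw [Matrix.sub_mulVec, Matrix.mulVec_mulVec, Matrix.mulVec_mulVec, sub_add_cancel]
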